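/- arXiv:1407.0889 — 2 statements merged into one kernel-verified Lean document; each statement's English description precedes it below -/
import Mathlib

section
/- For every bounded domain Ω ⊂ ℝⁿ, every p > 2, every ε > 0, every bounded Borel measurable F : Γ_ε → ℝ and every bounded Borel measurable f : Ω → ℝ with f > 0, there exists a unique bounded Borel measurable function u : Ω_ε → ℝ such that u = F on Γ_ε and u satisfies the DPP u(x) = (α/2)(sup_{B_ε(x)} u + inf_{B_ε(x)} u) + β ⨍_{B_ε(x)} u(y) dy + ε² f(x) for every x ∈ Ω. -/
open MeasureTheory Metric Set Filter ProbabilityTheory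

noncomputable section

/-- Euclidean space `ℝⁿ`. -/
abbrev En (n : ℕ) := EuclideanSpace ℝ (Fin n)

/-- The boundary strip `Γ_ε = {x ∈ ℝⁿ \ Ω : dist(x, ∂Ω) ≤ ε}`. -/
def bdryStrip (n : ℕ) (Ω : Set (En n)) (ε : ℝ) : Set (En n) :=
  {x | x ∉ Ω ∧ Metric.infDist x (frontier Ω) ≤ ε}

/-- The dynamic programming principle (DPP) with running payoff `f`:
`u x = (α/2)(sup_{B_ε(x)} u + inf_{B_ε(x)} u) + β ⨍_{B_ε(x)} u + ε² f x` for all `x ∈ Ω`. -/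
def SatisfiesDPP (n : ℕ) (α β ε : ℝ) (Ω : Set (En n)) (f u : En n → ℝ) : Prop :=
  ∀ x ∈ Ω, u x =
    α / 2 * (sSup (u '' Metric.ball x ε) + sInf (u '' Metric.ball x ε))
      + β * (⨍ y in Metric.ball x ε, u y) + ε ^ 2 * f x

/-- The right-hand side of the dynamic programming principle. -/
def dppRHS (n : ℕ) (α β ε : ℝ) (f u : En n → ℝ) (x : En n) : ℝ :=
  α / 2 * (sSup (u '' Metric.ball x ε) + sInf (u '' Metric.ball x ε))
    + β * (⨍ y in Metric.ball x ε, u y) + ε ^ 2 * f x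

lemma ball_subset_union_bdryStrip {n : ℕ} {Ω : Set (En n)} {ε : ℝ} {x : En n} (hx : x ∈ Ω) :
    ball x ε ⊆ Ω ∪ bdryStrip n Ω ε := by
  intro y hy
  by_cases hyΩ : y ∈ Ω
  · exact Or.inl hyΩ
  refine Or.inr ⟨hyΩ, ?_⟩
  obtain ⟨z, hz, hyz⟩ := exists_mem_frontier_infDist_compl_eq_dist (s := Ωᶜ) hyΩ
    fun h => (h ▸ mem_univ x : x ∈ Ωᶜ) hx
  rw [frontier_compl] at hz
  rw [compl_compl] at hyz
  calc infDist y (frontier Ω) ≤ dist y z := infDist_le_dist_of_mem hz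
    _ = infDist y Ω := hyz.symm
    _ ≤ dist y x := infDist_le_dist_of_mem hx
    _ ≤ ε := (mem_ball.1 hy).le

lemma measurableSet_bdryStrip {n : ℕ} {Ω : Set (En n)} (hΩ : MeasurableSet Ω) (ε : ℝ) :
    MeasurableSet (bdryStrip n Ω ε) :=
  hΩ.compl.inter (isClosed_le (continuous_infDist_pt _) continuous_const).measurableSet

section Extrema

variable {X : Type*} {s : Set X} {u v : X → ℝ} {M : ℝ}

lemma bddAbove_image_of_abs_le (h : ∀ x ∈ s, |u x| ≤ M) : BddAbove (u '' s) := by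
  refine ⟨M, ?_⟩
  rintro _ ⟨x, hx, rfl⟩
  exact (abs_le.1 (h x hx)).2

lemma bddBelow_image_of_abs_le (h : ∀ x ∈ s, |u x| ≤ M) : BddBelow (u '' s) := by
  refine ⟨-M, ?_⟩
  rintro _ ⟨x, hx, rfl⟩
  exact (abs_le.1 (h x hx)).1

lemma abs_sSup_image_sub_le (hs : s.Nonempty) (hu : BddAbove (u '' s)) (hv : BddAbove (v '' s))
    (h : ∀ x ∈ s, |u x - v x| ≤ M) : |sSup (u '' s) - sSup (v '' s)| ≤ M := by
  rw [abs_sub_le_iff, sub_le_iff_le_add, sub_le_iff_le_add]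
  constructor <;> refine csSup_le (hs.image _) ?_ <;> rintro _ ⟨x, hx, rfl⟩
  · linarith [(abs_le.1 (h x hx)).2, le_csSup hv (mem_image_of_mem v hx)]
  · linarith [(abs_le.1 (h x hx)).1, le_csSup hu (mem_image_of_mem u hx)]

lemma abs_sInf_image_sub_le (hs : s.Nonempty) (hu : BddBelow (u '' s)) (hv : BddBelow (v '' s))
    (h : ∀ x ∈ s, |u x - v x| ≤ M) : |sInf (u '' s) - sInf (v '' s)| ≤ M := by
  rw [abs_sub_le_iff, sub_le_comm, sub_le_comm (b := sInf (u '' s))]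
  constructor <;> refine le_csInf (hs.image _) ?_ <;> rintro _ ⟨x, hx, rfl⟩
  · linarith [(abs_le.1 (h x hx)).2, csInf_le hu (mem_image_of_mem u hx)]
  · linarith [(abs_le.1 (h x hx)).1, csInf_le hv (mem_image_of_mem v hx)]

end Extrema

section Measurability

variable {n : ℕ} {ε M : ℝ} {u : En n → ℝ}

lemma measurable_sSup_image_ball (hε : 0 < ε) (hM : ∀ x, |u x| ≤ M) :
    Measurable fun x => sSup (u '' ball x ε) := by
  refine measurable_of_Ioi fun a => IsOpen.measurableSet ?_
  have : (fun x => sSup (u '' ball x ε)) ⁻¹' Ioi a = ⋃ y ∈ {y | a < u y}, ball y ε := by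
    ext x
    simp only [mem_preimage, mem_Ioi, lt_csSup_iff (bddAbove_image_of_abs_le fun y _ => hM y)
      ((nonempty_ball.2 hε).image u), exists_mem_image, mem_iUnion, mem_ofPred_eq, exists_prop]
    exact exists_congr fun y => by rw [mem_ball_comm, and_comm]
  rw [this]
  exact isOpen_biUnion fun _ _ => isOpen_ball

lemma measurable_sInf_image_ball (hε : 0 < ε) (hM : ∀ x, |u x| ≤ M) :
    Measurable fun x => sInf (u '' ball x ε) := by
  refine measurable_of_Iio fun a => IsOpen.measurableSet ?_
  have : (fun x => sInf (u '' ball x ε)) ⁻¹' Iio a = ⋃ y ∈ {y | u y < a}, ball y ε := by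
    ext x
    simp only [mem_preimage, mem_Iio, csInf_lt_iff (bddBelow_image_of_abs_le fun y _ => hM y)
      ((nonempty_ball.2 hε).image u), exists_mem_image, mem_iUnion, mem_ofPred_eq, exists_prop]
    exact exists_congr fun y => by rw [mem_ball_comm, and_comm]
  rw [this]
  exact isOpen_biUnion fun _ _ => isOpen_ball

lemma measurable_setAverage_ball (hu : Measurable u) :
    Measurable fun x => ⨍ y in ball x ε, u y := by
  simp only [setAverage_eq, Measure.addHaar_real_ball_center, smul_eq_mul]
  refine Measurable.const_mul ?_ _
  have hs : MeasurableSet {q : En n × En n | dist q.2 q.1 < ε} :=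
    (isOpen_lt (continuous_snd.dist continuous_fst) continuous_const).measurableSet
  have := (((hu.comp measurable_snd).indicator hs).stronglyMeasurable.integral_prod_right'
    (ν := (volume : Measure (En n)))).measurable
  convert this using 2 with x
  rw [← integral_indicator measurableSet_ball]
  rfl

lemma measurable_dppRHS {α β : ℝ} {f : En n → ℝ} (hε : 0 < ε) (hf : Measurable f)
    (hu : Measurable u) (hM : ∀ x, |u x| ≤ M) : Measurable (dppRHS n α β ε f u) :=
  ((((measurable_sSup_image_ball hε hM).add (measurable_sInf_image_ball hε hM)).const_mul _).add
    ((measurable_setAverage_ball hu).const_mul _)).add (hf.const_mul _)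

end Measurability

/-- A weight that is a strict supersolution for the linearised dynamic programming principle. -/
structure IsDPPWeight (n : ℕ) (α β ε : ℝ) (Ω : Set (En n)) (φ : En n → ℝ) (C θ : ℝ) : Prop where
  continuous : Continuous φ
  le_const : ∀ x, φ x ≤ C
  one_le : ∀ x ∈ Ω, ∀ y ∈ ball x ε, 1 ≤ φ y
  rate_nonneg : 0 ≤ θ
  rate_lt_one : θ < 1
  const_add_average_le : ∀ x ∈ Ω, α * C + β * (⨍ y in ball x ε, φ y) ≤ θ * φ x

lemma integrableOn_ball_of_abs_le {n : ℕ} {x : En n} {ε M : ℝ} {u : En n → ℝ} (hu : Measurable u)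
    (hM : ∀ y ∈ ball x ε, |u y| ≤ M) : IntegrableOn u (ball x ε) :=
  Measure.integrableOn_of_bounded measure_ball_lt_top.ne hu.aestronglyMeasurable
    ((ae_restrict_iff' measurableSet_ball).2 (ae_of_all _ hM))

lemma integrableOn_ball_of_continuous {n : ℕ} {x : En n} {ε : ℝ} {u : En n → ℝ}
    (hu : Continuous u) : IntegrableOn u (ball x ε) :=
  (hu.continuousOn.integrableOn_compact (isCompact_closedBall x ε)).mono_set ball_subset_closedBall

lemma measureReal_ball_pos {n : ℕ} (x : En n) {r : ℝ} (hr : 0 < r) :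
    0 < volume.real (ball x r) :=
  ENNReal.toReal_pos (measure_ball_pos volume x hr).ne' measure_ball_lt_top.ne

/-- The averages over balls of radius `ε` of an exponential of large enough slope exceed any given
multiple of its value at the centre. -/
lemma exists_mul_exp_le_setAverage_ball {n : ℕ} (i : Fin n) {ε : ℝ} (hε : 0 < ε) (K : ℝ) :
    ∃ k : ℝ, 0 ≤ k ∧ ∀ x : En n,
      K * Real.exp (k * x i) ≤ ⨍ y in ball x ε, Real.exp (k * y i) := by
  set c : ℝ := volume.real (ball (0 : En n) (ε / 4)) / volume.real (ball (0 : En n) ε) with hc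
  have hV := measureReal_ball_pos (0 : En n) hε
  have hcpos : 0 < c := div_pos (measureReal_ball_pos _ (by positivity)) hV
  have hlim : Tendsto (fun k : ℝ => c * Real.exp (k * (ε / 4))) atTop atTop :=
    (Real.tendsto_exp_atTop.comp (tendsto_id.atTop_mul_const (by positivity))).const_mul_atTop hcpos
  obtain ⟨k, hk0, hkK⟩ := ((eventually_ge_atTop 0).and (hlim.eventually_ge_atTop K)).exists
  refine ⟨k, hk0, fun x => ?_⟩
  set z : En n := x + EuclideanSpace.single i (ε / 2) with hz
  have hzx : dist z x = ε / 2 := by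
    simp [hz, abs_of_pos hε]
  have hsub : ball z (ε / 4) ⊆ ball x ε := ball_subset_ball' (by rw [hzx]; linarith)
  have hcont : Continuous fun y : En n => Real.exp (k * y i) := by fun_prop
  have hlow : ∀ y ∈ ball z (ε / 4), Real.exp (k * (x i + ε / 4)) ≤ Real.exp (k * y i) := by
    intro y hy
    have h1 : |y i - z i| ≤ dist y z := by
      rw [dist_eq_norm]
      exact PiLp.norm_apply_le (y - z) i
    have h2 : z i = x i + ε / 2 := by simp [hz]
    have h3 := (abs_le.1 (h1.trans (mem_ball.1 hy).le)).1
    gcongr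
    linarith
  have hint : volume.real (ball (0 : En n) (ε / 4)) * Real.exp (k * (x i + ε / 4))
      ≤ ∫ y in ball x ε, Real.exp (k * y i) := by
    calc _ = ∫ y in ball z (ε / 4), Real.exp (k * (x i + ε / 4)) := by
          rw [setIntegral_const, Measure.addHaar_real_ball_center _ z, smul_eq_mul]
      _ ≤ ∫ y in ball z (ε / 4), Real.exp (k * y i) :=
          setIntegral_mono_on (integrableOn_ball_of_continuous continuous_const)
            (integrableOn_ball_of_continuous hcont) measurableSet_ball hlow
      _ ≤ _ := setIntegral_mono_set (integrableOn_ball_of_continuous hcont)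
            (ae_of_all _ fun y => (Real.exp_pos _).le) hsub.eventuallyLE
  rw [setAverage_eq, Measure.addHaar_real_ball_center, smul_eq_mul, inv_mul_eq_div]
  calc K * Real.exp (k * x i) ≤ c * Real.exp (k * (ε / 4)) * Real.exp (k * x i) := by gcongr
    _ = volume.real (ball (0 : En n) (ε / 4)) * Real.exp (k * (x i + ε / 4))
          / volume.real (ball (0 : En n) ε) := by
        rw [hc, mul_add, Real.exp_add]; ring
    _ ≤ _ := by gcongr

lemma exists_isDPPWeight {n : ℕ} (i : Fin n) {α β ε : ℝ} {Ω : Set (En n)} (hε : 0 < ε)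
    (hβ : 0 < β) (hαβ : α + β = 1) (hΩ : Bornology.IsBounded Ω) :
    ∃ φ C θ, IsDPPWeight n α β ε Ω φ C θ := by
  obtain ⟨k, hk, hkavg⟩ := exists_mul_exp_le_setAverage_ball i hε (2 / β)
  obtain ⟨R, hR0, hR⟩ : ∃ R : ℝ, 0 ≤ R ∧ ∀ x ∈ Ω, ‖x‖ ≤ R := by
    obtain ⟨R, hR⟩ := hΩ.exists_norm_le
    exact ⟨max R 0, le_max_right _ _, fun x hx => (hR x hx).trans (le_max_left _ _)⟩
  set ψ : En n → ℝ := fun y => Real.exp (k * y i) with hψ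
  have hψc : Continuous ψ := by fun_prop
  set C : ℝ := 1 + Real.exp (k * (R + ε)) with hC
  set δ : ℝ := Real.exp (-(k * R)) with hδ
  have hC1 : 1 ≤ C := by have := Real.exp_pos (k * (R + ε)); linarith
  have hδ0 : 0 < δ := Real.exp_pos _
  have hδ1 : δ ≤ 1 := Real.exp_le_one_iff.2 (by have := mul_nonneg hk hR0; linarith)
  have hδC : δ / C ≤ 1 := (div_le_one (by linarith)).2 (hδ1.trans hC1)
  refine ⟨fun y => C - ψ y, C, 1 - δ / C, ?_, ?_, ?_, ?_, ?_, ?_⟩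
  · fun_prop
  · intro x
    have := Real.exp_pos (k * x i)
    simp only [hψ]
    linarith
  · intro x hx y hy
    have h1 : y i ≤ R + ε := by
      have := PiLp.norm_apply_le y i
      have h2 : ‖y‖ ≤ ‖x‖ + dist y x := by
        rw [dist_eq_norm]; simpa using norm_add_le x (y - x)
      linarith [le_abs_self (y i), Real.norm_eq_abs (y i), hR x hx, mem_ball.1 hy]
    have : ψ y ≤ Real.exp (k * (R + ε)) := by
      simp only [hψ]; gcongr
    simp only [hC]
    linarith
  · linarith
  · linarith [div_pos hδ0 (by linarith : 0 < C)]
  · intro x hx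
    have hV := measureReal_ball_pos x hε
    have havg : ⨍ y in ball x ε, (C - ψ y) = C - ⨍ y in ball x ε, ψ y := by
      rw [setAverage_eq, setAverage_eq, integral_sub
        (integrableOn_ball_of_continuous continuous_const) (integrableOn_ball_of_continuous hψc), setIntegral_const]
      simp only [smul_eq_mul]
      field_simp
    have h1 := mul_le_mul_of_nonneg_left (hkavg x) hβ.le
    have h2 : β * (2 / β * ψ x) = 2 * ψ x := by field_simp
    have h3 : δ ≤ ψ x := by
      refine Real.exp_le_exp.2 ?_
      have := (neg_abs_le (x i)).trans' (neg_le_neg ((PiLp.norm_apply_le x i).trans (hR x hx)))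
      nlinarith
    have h4 : δ / C * (C - ψ x) ≤ δ := by
      have : 0 ≤ δ / C * ψ x := by positivity
      have h5 : δ / C * C = δ := by field_simp
      linarith
    have h6 : α * C + β * C = C := by rw [← add_mul, hαβ, one_mul]
    rw [havg]
    simp only [hψ] at *
    linarith

lemma IsDPPWeight.abs_dppRHS_sub_le {n : ℕ} {α β ε : ℝ} {Ω : Set (En n)} {φ : En n → ℝ} {C θ : ℝ}
    (hφ : IsDPPWeight n α β ε Ω φ C θ) (hε : 0 < ε) (hα : 0 ≤ α) (hβ : 0 ≤ β)
    {f u v : En n → ℝ} (hu : Measurable u) (hv : Measurable v) {x : En n} (hx : x ∈ Ω) {A B m : ℝ}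
    (hA : ∀ y ∈ ball x ε, |u y| ≤ A) (hB : ∀ y ∈ ball x ε, |v y| ≤ B) (hm : 0 ≤ m)
    (h : ∀ y ∈ ball x ε, |u y - v y| ≤ m * φ y) :
    |dppRHS n α β ε f u x - dppRHS n α β ε f v x| ≤ θ * (m * φ x) := by
  have hne : (ball x ε).Nonempty := nonempty_ball.2 hε
  have hmC : ∀ y ∈ ball x ε, |u y - v y| ≤ m * C := fun y hy =>
    (h y hy).trans (mul_le_mul_of_nonneg_left (hφ.le_const y) hm)
  have hsup := abs_sSup_image_sub_le hne (bddAbove_image_of_abs_le hA)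
    (bddAbove_image_of_abs_le hB) hmC
  have hinf := abs_sInf_image_sub_le hne (bddBelow_image_of_abs_le hA)
    (bddBelow_image_of_abs_le hB) hmC
  have hiu := integrableOn_ball_of_abs_le hu hA
  have hiv := integrableOn_ball_of_abs_le hv hB
  have havg : |(⨍ y in ball x ε, u y) - ⨍ y in ball x ε, v y| ≤ m * ⨍ y in ball x ε, φ y := by
    have hV := measureReal_ball_pos x hε
    simp only [setAverage_eq, smul_eq_mul]
    rw [← mul_sub, abs_mul, abs_of_pos (inv_pos.2 hV), mul_left_comm, ← integral_sub hiu hiv]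
    gcongr
    calc |∫ y in ball x ε, (u y - v y)| ≤ ∫ y in ball x ε, |u y - v y| :=
          abs_integral_le_integral_abs
      _ ≤ ∫ y in ball x ε, m * φ y :=
          setIntegral_mono_on (hiu.sub hiv).abs
            ((integrableOn_ball_of_continuous hφ.continuous).const_mul m) measurableSet_ball h
      _ = m * ∫ y in ball x ε, φ y := integral_const_mul _ _
  have hw := mul_le_mul_of_nonneg_left (hφ.const_add_average_le x hx) hm
  unfold dppRHS
  rw [abs_le] at *
  constructor
  · nlinarith [mul_le_mul_of_nonneg_left hsup.1 hα, mul_le_mul_of_nonneg_left hinf.1 hα,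
      mul_le_mul_of_nonneg_left havg.1 hβ]
  · nlinarith [mul_le_mul_of_nonneg_left hsup.2 hα, mul_le_mul_of_nonneg_left hinf.2 hα,
      mul_le_mul_of_nonneg_left havg.2 hβ]

lemma IsDPPWeight.const_nonneg_of_mem {n : ℕ} {α β ε : ℝ} {Ω : Set (En n)} {φ : En n → ℝ}
    {C θ : ℝ} (hφ : IsDPPWeight n α β ε Ω φ C θ) (hε : 0 < ε) {x : En n} (hx : x ∈ Ω) :
    0 ≤ C :=
  zero_le_one.trans ((hφ.one_le x hx x (mem_ball_self hε)).trans (hφ.le_const x))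

lemma IsDPPWeight.eqOn_of_eqOn_compl {n : ℕ} {α β ε : ℝ} {Ω : Set (En n)} {φ : En n → ℝ} {C θ : ℝ}
    (hφ : IsDPPWeight n α β ε Ω φ C θ) (hε : 0 < ε) (hα : 0 ≤ α) (hβ : 0 ≤ β)
    {f u v : En n → ℝ} (hu : Measurable u) (hv : Measurable v) {A B : ℝ}
    (hA : ∀ x ∈ Ω, ∀ y ∈ ball x ε, |u y| ≤ A) (hB : ∀ x ∈ Ω, ∀ y ∈ ball x ε, |v y| ≤ B)
    (heq : ∀ x ∈ Ω, ∀ y ∈ ball x ε, y ∉ Ω → u y = v y)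
    (hudpp : SatisfiesDPP n α β ε Ω f u) (hvdpp : SatisfiesDPP n α β ε Ω f v) : EqOn u v Ω := by
  intro x₀ hx₀
  have hAB : 0 ≤ A + B := add_nonneg
    ((abs_nonneg _).trans (hA x₀ hx₀ x₀ (mem_ball_self hε)))
    ((abs_nonneg _).trans (hB x₀ hx₀ x₀ (mem_ball_self hε)))
  have key : ∀ k : ℕ, ∀ x ∈ Ω, |u x - v x| ≤ θ ^ k * (A + B) * φ x := by
    intro k
    induction k with
    | zero =>
      intro x hx
      have h1 := hφ.one_le x hx x (mem_ball_self hε)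
      calc |u x - v x| ≤ |u x| + |v x| := abs_sub _ _
        _ ≤ A + B := add_le_add (hA x hx x (mem_ball_self hε)) (hB x hx x (mem_ball_self hε))
        _ ≤ θ ^ 0 * (A + B) * φ x := by rw [pow_zero, one_mul]; exact le_mul_of_one_le_right hAB h1
    | succ k ih =>
      intro x hx
      have hm : 0 ≤ θ ^ k * (A + B) := mul_nonneg (pow_nonneg hφ.rate_nonneg k) hAB
      have := hφ.abs_dppRHS_sub_le (f := f) hε hα hβ hu hv hx (hA x hx) (hB x hx) hm fun y hy => by
        by_cases hyΩ : y ∈ Ω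
        · exact ih y hyΩ
        · rw [heq x hx y hy hyΩ, sub_self, abs_zero]
          exact mul_nonneg hm (zero_le_one.trans (hφ.one_le x hx y hy))
      rw [hudpp x hx, hvdpp x hx]
      refine this.trans_eq ?_
      ring
  have hlim : Tendsto (fun k : ℕ => θ ^ k * (A + B) * φ x₀) atTop (nhds 0) := by
    simpa using ((tendsto_pow_atTop_nhds_zero_of_lt_one hφ.rate_nonneg
      hφ.rate_lt_one).mul_const (A + B)).mul_const (φ x₀)
  have := ge_of_tendsto' hlim fun k => key k x₀ hx₀
  exact sub_eq_zero.1 (abs_nonpos_iff.1 this)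

open scoped Classical in
/-- The iterates of the dynamic programming operator, started from the boundary values `G`. -/
def dppIterate (n : ℕ) (α β ε : ℝ) (Ω : Set (En n)) (f G : En n → ℝ) : ℕ → En n → ℝ
  | 0 => G
  | k + 1 => Ω.piecewise (dppRHS n α β ε f (dppIterate n α β ε Ω f G k)) G

section Iterate

variable {n : ℕ} {α β ε : ℝ} {Ω : Set (En n)} {φ : En n → ℝ} {C θ : ℝ} {f G : En n → ℝ} {M N : ℝ}

lemma dppIterate_of_notMem (k : ℕ) {x : En n} (hx : x ∉ Ω) :
    dppIterate n α β ε Ω f G k x = G x := by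
  classical
  cases k with
  | zero => rfl
  | succ k => exact piecewise_eq_of_notMem Ω _ _ hx

lemma dppIterate_succ_of_mem (k : ℕ) {x : En n} (hx : x ∈ Ω) :
    dppIterate n α β ε Ω f G (k + 1) x = dppRHS n α β ε f (dppIterate n α β ε Ω f G k) x := by
  classical
  exact piecewise_eq_of_mem Ω _ _ hx

lemma IsDPPWeight.exists_abs_dppRHS_le (hφ : IsDPPWeight n α β ε Ω φ C θ) (hε : 0 < ε)
    (hα : 0 ≤ α) (hβ : 0 ≤ β) (hf : ∀ x ∈ Ω, |f x| ≤ N) {u : En n → ℝ} (hu : Measurable u)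
    (hM : ∀ x, |u x| ≤ M) : ∃ K, ∀ x ∈ Ω, |dppRHS n α β ε f u x| ≤ K := by
  refine ⟨θ * (M * C) + ε ^ 2 * N, fun x hx => ?_⟩
  have hM0 : 0 ≤ M := (abs_nonneg _).trans (hM x)
  have hle := hφ.abs_dppRHS_sub_le (f := f) (v := fun _ => 0) (B := 0) hε hα hβ hu measurable_const
    hx (fun y _ => hM y) (fun y _ => abs_zero.le) hM0 fun y hy => by
      rw [sub_zero]
      exact (hM y).trans (le_mul_of_one_le_right hM0 (hφ.one_le x hx y hy))
  have hzero : dppRHS n α β ε f (fun _ => 0) x = ε ^ 2 * f x := by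
    simp [dppRHS, (nonempty_ball.2 hε).image_const]
  rw [hzero] at hle
  have hφC : θ * (M * φ x) ≤ θ * (M * C) :=
    mul_le_mul_of_nonneg_left (mul_le_mul_of_nonneg_left (hφ.le_const x) hM0) hφ.rate_nonneg
  have hfx : |ε ^ 2 * f x| ≤ ε ^ 2 * N := by
    rw [abs_mul, abs_of_nonneg (sq_nonneg ε)]
    exact mul_le_mul_of_nonneg_left (hf x hx) (sq_nonneg ε)
  linarith [abs_sub_abs_le_abs_sub (dppRHS n α β ε f u x) (ε ^ 2 * f x)]

lemma IsDPPWeight.measurable_and_bounded_dppIterate (hφ : IsDPPWeight n α β ε Ω φ C θ) (hε : 0 < ε)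
    (hα : 0 ≤ α) (hβ : 0 ≤ β) (hΩ : MeasurableSet Ω) (hG : Measurable G) (hM : ∀ x, |G x| ≤ M)
    (hf : Measurable f) (hN : ∀ x ∈ Ω, |f x| ≤ N) (k : ℕ) :
    Measurable (dppIterate n α β ε Ω f G k) ∧ ∃ K, ∀ x, |dppIterate n α β ε Ω f G k x| ≤ K := by
  classical
  induction k with
  | zero => exact ⟨hG, M, hM⟩
  | succ k ih =>
    obtain ⟨hmeas, K, hK⟩ := ih
    refine ⟨(measurable_dppRHS hε hf hmeas hK).piecewise hΩ hG, ?_⟩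
    obtain ⟨L, hL⟩ := hφ.exists_abs_dppRHS_le hε hα hβ hN hmeas hK
    refine ⟨max L M, fun x => ?_⟩
    by_cases hx : x ∈ Ω
    · rw [dppIterate_succ_of_mem k hx]
      exact (hL x hx).trans (le_max_left _ _)
    · rw [dppIterate_of_notMem _ hx]
      exact (hM x).trans (le_max_right _ _)

lemma exists_dpp_solution (hε : 0 < ε) (hα : 0 ≤ α) (hβ : 0 ≤ β)
    (hφ : IsDPPWeight n α β ε Ω φ C θ) (hΩ : MeasurableSet Ω) (hG : Measurable G)
    (hM : ∀ x, |G x| ≤ M) (hf : Measurable f) (hN : ∀ x ∈ Ω, |f x| ≤ N) :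
    ∃ u : En n → ℝ, Measurable u ∧ (∃ K, ∀ x, |u x| ≤ K) ∧ (∀ x ∉ Ω, u x = G x) ∧
      SatisfiesDPP n α β ε Ω f u := by
  rcases Ω.eq_empty_or_nonempty with rfl | ⟨x₀, hx₀⟩
  · exact ⟨G, hG, ⟨M, hM⟩, fun _ _ => rfl, fun x hx => hx.elim⟩
  have hC := hφ.const_nonneg_of_mem hε hx₀
  set U := dppIterate n α β ε Ω f G with hU
  have hUmb := hφ.measurable_and_bounded_dppIterate hε hα hβ hΩ hG hM hf hN
  obtain ⟨D, hD⟩ := (hUmb 1).2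
  have hDM : 0 ≤ D + M := add_nonneg ((abs_nonneg _).trans (hD x₀)) ((abs_nonneg _).trans (hM x₀))
  have key : ∀ k : ℕ, ∀ x ∈ Ω, |U k x - U (k + 1) x| ≤ θ ^ k * (D + M) * φ x := by
    intro k
    induction k with
    | zero =>
      intro x hx
      calc |U 0 x - U 1 x| ≤ |U 0 x| + |U 1 x| := abs_sub _ _
        _ ≤ D + M := by linarith [hD x, hM x, show |U 0 x| = |G x| from rfl]
        _ ≤ θ ^ 0 * (D + M) * φ x := by
          rw [pow_zero, one_mul]
          exact le_mul_of_one_le_right hDM (hφ.one_le x hx x (mem_ball_self hε))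
    | succ k ih =>
      intro x hx
      have hm : 0 ≤ θ ^ k * (D + M) := mul_nonneg (pow_nonneg hφ.rate_nonneg k) hDM
      obtain ⟨hm1, K1, hK1⟩ := hUmb k
      obtain ⟨hm2, K2, hK2⟩ := hUmb (k + 1)
      have := hφ.abs_dppRHS_sub_le (f := f) hε hα hβ hm1 hm2 hx (fun y _ => hK1 y)
        (fun y _ => hK2 y) hm fun y hy => by
          by_cases hyΩ : y ∈ Ω
          · exact ih y hyΩ
          · rw [dppIterate_of_notMem _ hyΩ, dppIterate_of_notMem _ hyΩ, sub_self, abs_zero]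
            exact mul_nonneg hm (zero_le_one.trans (hφ.one_le x hx y hy))
      rw [hU, dppIterate_succ_of_mem k hx, dppIterate_succ_of_mem (k + 1) hx]
      refine this.trans_eq ?_
      ring
  have hdist : ∀ x k, dist (U k x) (U (k + 1) x) ≤ (D + M) * C * θ ^ k := by
    intro x k
    have hθk := pow_nonneg hφ.rate_nonneg k
    rw [Real.dist_eq]
    by_cases hx : x ∈ Ω
    · calc _ ≤ θ ^ k * (D + M) * φ x := key k x hx
        _ ≤ θ ^ k * (D + M) * C :=
          mul_le_mul_of_nonneg_left (hφ.le_const x) (mul_nonneg hθk hDM)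
        _ = _ := by ring
    · rw [hU, dppIterate_of_notMem _ hx, dppIterate_of_notMem _ hx, sub_self, abs_zero]
      positivity
  choose u hu using fun x =>
    cauchySeq_tendsto_of_complete (cauchySeq_of_le_geometric θ _ hφ.rate_lt_one (hdist x))
  have hrate : ∀ x k, |U k x - u x| ≤ (D + M) * C * θ ^ k / (1 - θ) := fun x k =>
    dist_le_of_le_geometric_of_tendsto θ _ hφ.rate_lt_one (hdist x) (hu x) k
  have humeas : Measurable u :=
    measurable_of_tendsto_metrizable (fun k => (hUmb k).1) (tendsto_pi_nhds.2 hu)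
  have hubdd : ∀ x, |u x| ≤ M + (D + M) * C * θ ^ 0 / (1 - θ) := fun x => by
    have := abs_sub_abs_le_abs_sub (u x) (U 0 x)
    rw [abs_sub_comm] at this
    linarith [hrate x 0, hM x, show |U 0 x| = |G x| from rfl]
  refine ⟨u, humeas, ⟨_, hubdd⟩, fun x hx => ?_, fun x hx => ?_⟩
  · refine tendsto_nhds_unique (hu x) ?_
    simp only [hU, dppIterate_of_notMem _ hx]
    exact tendsto_const_nhds
  · change u x = dppRHS n α β ε f u x
    refine tendsto_nhds_unique ((tendsto_add_atTop_iff_nat 1).2 (hu x)) ?_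
    simp only [hU, dppIterate_succ_of_mem _ hx]
    rw [tendsto_iff_dist_tendsto_zero]
    have hlim : Tendsto (fun k : ℕ => θ * ((D + M) * C * θ ^ k / (1 - θ) * φ x)) atTop (nhds 0) := by
      simpa using (((((tendsto_pow_atTop_nhds_zero_of_lt_one hφ.rate_nonneg
        hφ.rate_lt_one).const_mul ((D + M) * C)).div_const (1 - θ)).mul_const (φ x)).const_mul θ)
    refine squeeze_zero (fun _ => dist_nonneg) (fun k => ?_) hlim
    obtain ⟨hmeas, K, hK⟩ := hUmb k
    have hm := (abs_nonneg _).trans (hrate x k)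
    exact hφ.abs_dppRHS_sub_le hε hα hβ hmeas humeas hx (fun y _ => hK y) (fun y _ => hubdd y) hm
      fun y hy => (hrate y k).trans (le_mul_of_one_le_right hm (hφ.one_le x hx y hy))

end Iterate

/-- Lemma 2.1. Existence and uniqueness of a bounded Borel measurable
solution of the DPP with prescribed values `F` on the boundary strip `Γ_ε`. -/
theorem dpp_existence_uniqueness
    (n : ℕ) (hn : 2 ≤ n) (Ω : Set (En n))
    (hΩopen : IsOpen Ω) (hΩbdd : Bornology.IsBounded Ω) (hΩconn : IsConnected Ω)
    (p : ℝ) (hp : 2 < p) (ε : ℝ) (hε : 0 < ε)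
    (α β : ℝ) (hα : α = (p - 2) / (n + p)) (hβ : β = (n + 2) / (n + p))
    (F f : En n → ℝ)
    (hFmeas : Measurable F) (hFbdd : ∃ M, ∀ x ∈ bdryStrip n Ω ε, |F x| ≤ M)
    (hfmeas : Measurable f) (hfbdd : ∃ M, ∀ x ∈ Ω, |f x| ≤ M)
    (hfpos : ∀ x ∈ Ω, 0 < f x) :
    ∃ u : En n → ℝ,
      (Measurable u ∧ (∃ M, ∀ x ∈ Ω ∪ bdryStrip n Ω ε, |u x| ≤ M) ∧
        Set.EqOn u F (bdryStrip n Ω ε) ∧ SatisfiesDPP n α β ε Ω f u) ∧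
      ∀ v : En n → ℝ,
        (Measurable v ∧ (∃ M, ∀ x ∈ Ω ∪ bdryStrip n Ω ε, |v x| ≤ M) ∧
          Set.EqOn v F (bdryStrip n Ω ε) ∧ SatisfiesDPP n α β ε Ω f v) →
        Set.EqOn v u (Ω ∪ bdryStrip n Ω ε) := by
  classical
  have hn0 : (2 : ℝ) ≤ n := by exact_mod_cast hn
  have hα0 : 0 ≤ α := hα ▸ div_nonneg (by linarith) (by linarith)
  have hβ0 : 0 < β := hβ ▸ div_pos (by linarith) (by linarith)
  have hαβ : α + β = 1 := by
    have : (n + p : ℝ) ≠ 0 := by linarith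
    rw [hα, hβ]
    field_simp
    ring
  obtain ⟨φ, C, θ, hφ⟩ := exists_isDPPWeight (⟨0, by omega⟩ : Fin n) hε hβ0 hαβ hΩbdd
  obtain ⟨MF, hMF⟩ := hFbdd
  obtain ⟨Mf, hMf⟩ := hfbdd
  have hsub : ∀ x ∈ Ω, ball x ε ⊆ Ω ∪ bdryStrip n Ω ε := fun x hx =>
    ball_subset_union_bdryStrip hx
  obtain ⟨u, humeas, hubdd, huG, hudpp⟩ := exists_dpp_solution hε hα0 hβ0.le hφ hΩopen.measurableSet
    (hFmeas.indicator (measurableSet_bdryStrip hΩopen.measurableSet ε)) (M := max MF 0)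
    (fun x => by
      by_cases hx : x ∈ bdryStrip n Ω ε
      · simpa [indicator_of_mem hx] using Or.inl (hMF x hx)
      · simp [indicator_of_notMem hx]) hfmeas hMf
  have huF : EqOn u F (bdryStrip n Ω ε) := fun x hx => by
    rw [huG x hx.1, indicator_of_mem hx]
  obtain ⟨A, hA⟩ := hubdd
  refine ⟨u, ⟨humeas, ⟨A, fun x _ => hA x⟩, huF, hudpp⟩, ?_⟩
  rintro v ⟨hvmeas, ⟨B, hB⟩, hvF, hvdpp⟩
  have heq : EqOn v u (bdryStrip n Ω ε) := fun x hx => (hvF hx).trans (huF hx).symm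
  have hΩeq : EqOn v u Ω := hφ.eqOn_of_eqOn_compl hε hα0 hβ0.le hvmeas humeas
    (fun x hx y hy => hB y (hsub x hx hy)) (fun x hx y _ => hA y)
    (fun x hx y hy hyΩ => heq ((hsub x hx hy).resolve_left hyΩ)) hvdpp hudpp
  exact hΩeq.union heq
end
end

section
/- Uniform bound independent of ε: there exist constants C > 0 and ε_0 > 0, depending only on p, n and Ω, such that for every ε ∈ (0, ε_0), every bounded Borel measurable F : Γ_ε → ℝ, every bounded Borel measurable f : Ω → ℝ with f > 0, and every bounded Borel measurable u : Ω_ε → ℝ satisfying u = F on Γ_ε and the DPP u(x) = (α/2)(sup_{B_ε(x)} u + inf_{B_ε(x)} u) + β ⨍_{B_ε(x)} u(y) dy + ε² f(x) for all x ∈ Ω, one has u ≤ sup_{Γ_ε} F + C sup_Ω f on Ω_ε; in particular u ≤ C' (sup_{Γ_ε} F + sup_Ω f) when sup_{Γ_ε} F ≥ 0. -/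
open MeasureTheory Metric Set Filter ProbabilityTheory

noncomputable section

lemma IsPreconnected.exists_mem_frontier {X : Type*} [TopologicalSpace X] {s t : Set X}
    (hs : IsPreconnected s) {x y : X} (hx : x ∈ s) (hxt : x ∈ t) (hy : y ∈ s) (hyt : y ∉ t) :
    ∃ z ∈ s, z ∈ frontier t := by
  by_contra! h
  have hx' : x ∈ interior t := by
    by_contra hxi
    exact h x hx ⟨subset_closure hxt, hxi⟩
  have hy' : y ∉ closure t := fun hyc => h y hy ⟨hyc, fun hyi => hyt (interior_subset hyi)⟩
  obtain ⟨z, -, hzi, hzc⟩ := hs (interior t) (closure t)ᶜ isOpen_interior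
    isClosed_closure.isOpen_compl
    (fun z hz => by
      by_cases hzc : z ∈ closure t
      · exact Or.inl (by_contra fun hzi => h z hz ⟨hzc, hzi⟩)
      · exact Or.inr hzc)
    ⟨x, hx, hx'⟩ ⟨y, hy, hy'⟩
  exact hzc (subset_closure (interior_subset hzi))

lemma union_bdryStrip_subset_closedBall {n : ℕ} {Ω : Set (En n)} {ε R : ℝ}
    (hR : Ω ⊆ closedBall 0 R) (hfr : (frontier Ω).Nonempty) (hε : ε < 1) :
    Ω ∪ bdryStrip n Ω ε ⊆ closedBall 0 (R + 1) := by
  rintro x (hx | ⟨-, hx⟩)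
  · exact closedBall_subset_closedBall (by linarith) (hR hx)
  · obtain ⟨z, hz, hxz⟩ := (infDist_lt_iff hfr).mp (hx.trans_lt hε)
    have hzR : z ∈ closedBall 0 R := closure_minimal hR isClosed_closedBall hz.1
    rw [mem_closedBall] at hzR ⊢
    linarith [dist_triangle x z 0]

lemma frontier_nonempty_of_isBounded {E : Type*} [NormedAddCommGroup E] [NormedSpace ℝ E]
    [Nontrivial E] {s : Set E} (hs : s.Nonempty) (hb : Bornology.IsBounded s) :
    (frontier s).Nonempty :=
  nonempty_frontier_iff.mpr ⟨hs, fun h => NormedSpace.unbounded_univ ℝ E (h ▸ hb)⟩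

lemma setIntegral_inner_sub_ball_center {n : ℕ} (x : En n) (ε : ℝ) :
    ∫ y in ball x ε, inner ℝ x (y - x) = 0 := by
  have hmp := Measure.measurePreserving_sub_left (volume : Measure (En n)) (x + x)
  have hpre : (fun y : En n => x + x - y) ⁻¹' ball x ε = ball x ε := by
    ext y
    simp only [mem_preimage, mem_ball, dist_eq_norm]
    rw [show x + x - y - x = -(y - x) by abel, norm_neg]
  have h := hmp.setIntegral_preimage_emb
    (MeasurableEquiv.subLeft (x + x)).measurableEmbedding
    (fun y => inner ℝ x (y - x)) (ball x ε)
  rw [hpre] at h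
  have hneg : ∀ y : En n, inner ℝ x (x + x - y - x) = -inner ℝ x (y - x) := by
    intro y
    rw [show x + x - y - x = -(y - x) by abel, inner_neg_right]
  simp only [hneg, integral_neg] at h
  linarith

/-- A function bounded on a ball by the concave paraboloid `P - K‖y‖²` has mean at most
the value of the paraboloid at the center. -/
lemma average_ball_le_of_le_paraboloid {n : ℕ} {u : En n → ℝ} {x : En n} {ε P K : ℝ}
    (hε : 0 < ε) (hK : 0 ≤ K) (hui : IntegrableOn u (ball x ε))
    (hu : ∀ y ∈ ball x ε, u y ≤ P - K * ‖y‖ ^ 2) :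
    ⨍ y in ball x ε, u y ≤ P - K * ‖x‖ ^ 2 := by
  have hV : 0 < volume.real (ball x ε) :=
    ENNReal.toReal_pos (measure_ball_pos volume x hε).ne' measure_ball_lt_top.ne
  have hc : IntegrableOn (fun _ : En n => P - K * ‖x‖ ^ 2) (ball x ε) :=
    integrableOn_const measure_ball_lt_top.ne
  have hi : IntegrableOn (fun y : En n => 2 * K * inner ℝ x (y - x)) (ball x ε) :=
    ((by fun_prop : Continuous fun y : En n => 2 * K * inner ℝ x (y - x)).continuousOn
      |>.integrableOn_compact (isCompact_closedBall x ε)).mono_set ball_subset_closedBall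
  have hle : ∫ y in ball x ε, u y ≤
      ∫ y in ball x ε, ((P - K * ‖x‖ ^ 2) - 2 * K * inner ℝ x (y - x)) := by
    refine setIntegral_mono_on hui (hc.sub hi) measurableSet_ball fun y hy => ?_
    have hexp := norm_add_sq_real x (y - x)
    rw [add_sub_cancel] at hexp
    have := hu y hy
    nlinarith [mul_nonneg hK (sq_nonneg ‖y - x‖)]
  rw [integral_sub hc hi, integral_const_mul, setIntegral_inner_sub_ball_center,
    setIntegral_const, smul_eq_mul] at hle
  rw [setAverage_eq, smul_eq_mul, inv_mul_le_iff₀ hV]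
  linarith

lemma exists_mem_ball_norm_eq_add {E : Type*} [NormedAddCommGroup E] [NormedSpace ℝ E]
    [Nontrivial E] (x : E) {t ε : ℝ} (ht : 0 ≤ t) (htε : t < ε) :
    ∃ y ∈ ball x ε, ‖y‖ = ‖x‖ + t := by
  obtain ⟨e, he, hxe⟩ : ∃ e : E, ‖e‖ = 1 ∧ x = ‖x‖ • e := by
    by_cases hx : x = 0
    · obtain ⟨e, he⟩ := exists_norm_eq E zero_le_one
      exact ⟨e, he, by simp [hx]⟩
    · have hx' : ‖x‖ ≠ 0 := norm_ne_zero_iff.mpr hx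
      refine ⟨‖x‖⁻¹ • x, ?_, ?_⟩
      · rw [norm_smul, norm_inv, norm_norm, inv_mul_cancel₀ hx']
      · rw [smul_smul, mul_inv_cancel₀ hx', one_smul]
  refine ⟨x + t • e, ?_, ?_⟩
  · rwa [mem_ball, dist_eq_norm, add_sub_cancel_left, norm_smul, he, mul_one,
      Real.norm_of_nonneg ht]
  · conv_lhs => rw [hxe]
    rw [← add_smul, norm_smul, he, mul_one, Real.norm_of_nonneg (by positivity)]

/-- A function bounded on a ball of radius `ε` by the concave paraboloid `P - K‖y‖²` has
midrange at most the value of the paraboloid at the center minus `K ε² / 2`. -/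
lemma midrange_ball_le_of_le_paraboloid {E : Type*} [NormedAddCommGroup E] [NormedSpace ℝ E]
    [Nontrivial E] {u : E → ℝ} {x : E} {ε P K : ℝ}
    (hε : 0 < ε) (hK : 0 ≤ K) (hbdd : BddBelow (u '' ball x ε))
    (hu : ∀ y ∈ ball x ε, u y ≤ P - K * ‖y‖ ^ 2) :
    (sSup (u '' ball x ε) + sInf (u '' ball x ε)) / 2 ≤
      P - K * ‖x‖ ^ 2 - K * ε ^ 2 / 2 := by
  have hsup : sSup (u '' ball x ε) ≤ P - K * max (‖x‖ - ε) 0 ^ 2 := by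
    refine csSup_le ⟨u x, mem_image_of_mem u (mem_ball_self hε)⟩ ?_
    rintro _ ⟨y, hy, rfl⟩
    have h1 : max (‖x‖ - ε) 0 ≤ ‖y‖ := by
      refine max_le ?_ (norm_nonneg y)
      have h2 := norm_sub_norm_le x y
      rw [mem_ball, dist_comm, dist_eq_norm] at hy
      linarith
    have h3 : max (‖x‖ - ε) 0 ^ 2 ≤ ‖y‖ ^ 2 := pow_le_pow_left₀ (le_max_right _ _) h1 2
    linarith [hu y hy, mul_le_mul_of_nonneg_left h3 hK]
  have hinf : sInf (u '' ball x ε) ≤ P - K * (‖x‖ + ε) ^ 2 := by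
    have hcl : IsClosed {t : ℝ | sInf (u '' ball x ε) ≤ P - K * (‖x‖ + t) ^ 2} :=
      isClosed_le continuous_const (by fun_prop)
    have hsub : Ico 0 ε ⊆ {t : ℝ | sInf (u '' ball x ε) ≤ P - K * (‖x‖ + t) ^ 2} := by
      rintro t ⟨ht, htε⟩
      obtain ⟨y, hy, hyn⟩ := exists_mem_ball_norm_eq_add x ht htε
      have h := (csInf_le hbdd (mem_image_of_mem u hy)).trans (hu y hy)
      rwa [hyn] at h
    have hmem := hcl.closure_subset_iff.mpr hsub
    rw [closure_Ico hε.ne] at hmem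
    exact hmem (right_mem_Icc.mpr hε.le)
  have hkey : 2 * ‖x‖ ^ 2 + ε ^ 2 ≤ max (‖x‖ - ε) 0 ^ 2 + (‖x‖ + ε) ^ 2 := by
    rcases le_total ε ‖x‖ with h | h
    · rw [max_eq_left (by linarith)]
      nlinarith [sq_nonneg ε]
    · rw [max_eq_right (by linarith)]
      nlinarith [norm_nonneg x]
  nlinarith [mul_le_mul_of_nonneg_left hkey hK]

/-- Comparison of a bounded solution of the DPP with a concave paraboloid. -/
lemma SatisfiesDPP.le_paraboloid {n : ℕ} [Nontrivial (En n)] {α β ε K P S : ℝ}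
    {Ω : Set (En n)} {f u : En n → ℝ} (hα : 0 < α) (hβ : 0 ≤ β) (hαβ : α + β = 1)
    (hε : 0 < ε) (hK : 0 ≤ K) (hum : Measurable u)
    (hub : ∃ M, ∀ x ∈ Ω ∪ bdryStrip n Ω ε, |u x| ≤ M)
    (hΓ : ∀ x ∈ bdryStrip n Ω ε, u x ≤ P - K * ‖x‖ ^ 2)
    (hbdd : Bornology.IsBounded (Ω ∪ bdryStrip n Ω ε))
    (hf : ∀ x ∈ Ω, f x ≤ S) (hSK : S < α * K / 2)
    (h : SatisfiesDPP n α β ε Ω f u) :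
    ∀ x ∈ Ω ∪ bdryStrip n Ω ε, u x ≤ P - K * ‖x‖ ^ 2 := by
  intro x₀ hx₀
  obtain ⟨M, hM⟩ := hub
  obtain ⟨R, hR⟩ := hbdd.exists_norm_le
  set w : En n → ℝ := fun x => u x - (P - K * ‖x‖ ^ 2) with hw
  have hwb : BddAbove (w '' (Ω ∪ bdryStrip n Ω ε)) := by
    refine ⟨M - P + K * R ^ 2, ?_⟩
    rintro _ ⟨x, hx, rfl⟩
    have h1 : ‖x‖ ^ 2 ≤ R ^ 2 := pow_le_pow_left₀ (norm_nonneg x) (hR x hx) 2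
    have h2 := (abs_le.mp (hM x hx)).2
    have h3 := mul_le_mul_of_nonneg_left h1 hK
    simp only [hw]
    linarith
  set D := sSup (w '' (Ω ∪ bdryStrip n Ω ε))
  have hwD : ∀ x ∈ Ω ∪ bdryStrip n Ω ε, w x ≤ D := fun x hx =>
    le_csSup hwb (mem_image_of_mem w hx)
  have hstep : ∀ x ∈ Ω, w x ≤ D - ε ^ 2 * (α * K / 2 - S) := by
    intro x hx
    have hsub := ball_subset_union_bdryStrip (ε := ε) hx
    have hu : ∀ y ∈ ball x ε, u y ≤ (P + D) - K * ‖y‖ ^ 2 := fun y hy => by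
      have := hwD y (hsub hy)
      simp only [hw] at this
      linarith
    have hbelow : BddBelow (u '' ball x ε) := by
      refine ⟨-M, ?_⟩
      rintro _ ⟨y, hy, rfl⟩
      exact (abs_le.mp (hM y (hsub hy))).1
    have hint : IntegrableOn u (ball x ε) :=
      Measure.integrableOn_of_bounded measure_ball_lt_top.ne hum.aestronglyMeasurable
        (ae_restrict_of_forall_mem measurableSet_ball fun y hy => hM y (hsub hy))
    have hmid := mul_le_mul_of_nonneg_left
      (midrange_ball_le_of_le_paraboloid hε hK hbelow hu) hα.le
    have havg := mul_le_mul_of_nonneg_left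
      (average_ball_le_of_le_paraboloid hε hK hint hu) hβ
    have hfx := mul_le_mul_of_nonneg_left (hf x hx) (sq_nonneg ε)
    have heq := h x hx
    have hsum : α * (P + D - K * ‖x‖ ^ 2) + β * (P + D - K * ‖x‖ ^ 2) =
        P + D - K * ‖x‖ ^ 2 := by rw [← add_mul, hαβ, one_mul]
    simp only [hw]
    linarith
  have hgap : 0 < ε ^ 2 * (α * K / 2 - S) := mul_pos (by positivity) (by linarith)
  have hmax : D ≤ max 0 (D - ε ^ 2 * (α * K / 2 - S)) := by
    refine csSup_le ⟨w x₀, mem_image_of_mem w hx₀⟩ ?_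
    rintro _ ⟨x, hx | hx, rfl⟩
    · exact (hstep x hx).trans (le_max_right _ _)
    · refine le_trans ?_ (le_max_left _ _)
      simpa only [hw, sub_nonpos] using hΓ x hx
  have hD0 : D ≤ 0 := by
    rcases le_max_iff.mp hmax with h0 | h0
    · exact h0
    · linarith
  simpa only [hw, sub_nonpos] using (hwD x₀ hx₀).trans hD0

/-- Lemma 3.1. Uniform bound, independent of `ε`: there are constants
`C, C' > 0` and `ε₀ > 0` depending only on `p`, `n`, `Ω` such that every bounded Borel
solution of the DPP with boundary data `F` and positive running payoff `f` satisfies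
`u ≤ sup_{Γ_ε} F + C sup_Ω f` on `Ω_ε`, and `u ≤ C'(sup_{Γ_ε} F + sup_Ω f)` when
`sup_{Γ_ε} F ≥ 0`. -/
theorem value_functions_uniformly_bounded
    (n : ℕ) (hn : 2 ≤ n) (Ω : Set (En n))
    (hΩopen : IsOpen Ω) (hΩbdd : Bornology.IsBounded Ω) (hΩconn : IsConnected Ω)
    (p : ℝ) (hp : 2 < p)
    (α β : ℝ) (hα : α = (p - 2) / (n + p)) (hβ : β = (n + 2) / (n + p)) :
    ∃ C > (0 : ℝ), ∃ C' > (0 : ℝ), ∃ ε₀ > (0 : ℝ), ∀ ε : ℝ, 0 < ε → ε < ε₀ →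
      ∀ F f u : En n → ℝ,
        Measurable F → (∃ M, ∀ x ∈ bdryStrip n Ω ε, |F x| ≤ M) →
        Measurable f → (∃ M, ∀ x ∈ Ω, |f x| ≤ M) → (∀ x ∈ Ω, 0 < f x) →
        Measurable u → (∃ M, ∀ x ∈ Ω ∪ bdryStrip n Ω ε, |u x| ≤ M) →
        Set.EqOn u F (bdryStrip n Ω ε) → SatisfiesDPP n α β ε Ω f u →
        (∀ x ∈ Ω ∪ bdryStrip n Ω ε,
            u x ≤ sSup (F '' bdryStrip n Ω ε) + C * sSup (f '' Ω)) ∧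
        (0 ≤ sSup (F '' bdryStrip n Ω ε) → ∀ x ∈ Ω ∪ bdryStrip n Ω ε,
            u x ≤ C' * (sSup (F '' bdryStrip n Ω ε) + sSup (f '' Ω))) := by
  have : Nontrivial (En n) :=
    Module.nontrivial_of_finrank_pos (R := ℝ) (by rw [finrank_euclideanSpace_fin]; omega)
  have hnp : 0 < (n : ℝ) + p := by positivity
  have hα0 : 0 < α := hα ▸ div_pos (by linarith) hnp
  have hβ0 : 0 ≤ β := hβ ▸ by positivity
  have hαβ : α + β = 1 := by
    rw [hα, hβ]
    field_simp
    ring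
  obtain ⟨R₀, hR₀⟩ := hΩbdd.subset_closedBall 0
  have hfr := frontier_nonempty_of_isBounded hΩconn.nonempty hΩbdd
  set R := R₀ + 1
  set C : ℝ := 4 / α * R ^ 2 + 1 with hC
  have hC0 : 0 < C := by positivity
  refine ⟨C, hC0, C + 1, by positivity, 1, one_pos, ?_⟩
  intro ε hε hε1 F f u _ ⟨MF, hMF⟩ _ ⟨Mf, hMf⟩ hfpos hum hub huF hdpp
  have hsub := union_bdryStrip_subset_closedBall hR₀ hfr hε1
  set G := sSup (F '' bdryStrip n Ω ε)
  set S := sSup (f '' Ω)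
  have hfS : ∀ x ∈ Ω, f x ≤ S := fun x hx =>
    le_csSup ⟨Mf, by rintro _ ⟨y, hy, rfl⟩; exact (abs_le.mp (hMf y hy)).2⟩
      (mem_image_of_mem f hx)
  have hFG : ∀ x ∈ bdryStrip n Ω ε, F x ≤ G := fun x hx =>
    le_csSup ⟨MF, by rintro _ ⟨y, hy, rfl⟩; exact (abs_le.mp (hMF y hy)).2⟩
      (mem_image_of_mem F hx)
  obtain ⟨z, hz⟩ := hΩconn.nonempty
  have hS : 0 < S := (hfpos z hz).trans_le (hfS z hz)
  have hK : 0 ≤ 4 / α * S := by positivity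
  have hcmp := hdpp.le_paraboloid (K := 4 / α * S) (P := G + 4 / α * S * R ^ 2) (S := S)
    hα0 hβ0 hαβ hε hK hum hub
    (fun x hx => by
      have hxR : ‖x‖ ≤ R := mem_closedBall_zero_iff.mp (hsub (Or.inr hx))
      have h1 := mul_le_mul_of_nonneg_left (pow_le_pow_left₀ (norm_nonneg x) hxR 2) hK
      rw [huF hx]
      linarith [hFG x hx])
    (isBounded_closedBall.subset hsub) hfS
    (by
      have : α * (4 / α * S) / 2 = 2 * S := by
        field_simp
        ring
      linarith)
  have hmain : ∀ x ∈ Ω ∪ bdryStrip n Ω ε, u x ≤ G + C * S := by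
    intro x hx
    have h1 := hcmp x hx
    have h2 := mul_nonneg hK (sq_nonneg ‖x‖)
    have h3 : C * S = 4 / α * S * R ^ 2 + S := by
      rw [hC]
      ring
    linarith
  refine ⟨hmain, fun hG x hx => ?_⟩
  nlinarith [hmain x hx, mul_nonneg hC0.le hG]
end
end
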